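/- arXiv:2409.08727 — 2 statements merged into one kernel-verified Lean document; each statement's English description precedes it below -/
import Mathlib

section
/- Let Γ be an alphabet and B be a zero-sum-free strong bimonoid. Then the following two statements are equivalent: (1) for all a,b,c ∈ B, (a ⊕ b) ⊗ c ≠ 𝟘 implies a ⊗ c ≠ 𝟘 or b ⊗ c ≠ 𝟘; (2) for each weighted automaton A over Γ and B, supp(⟦A⟧^init) ⊆ supp(⟦A⟧^run). -/
/-! Strong bimonoids -/

structure StrongBimonoid (B : Type) where
  add : B → B → B
  mul : B → B → B
  zero : B
  one : B
  add_assoc : ∀ a b c, add (add a b) c = add a (add b c)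
  add_comm : ∀ a b, add a b = add b a
  add_zero : ∀ a, add a zero = a
  mul_assoc : ∀ a b c, mul (mul a b) c = mul a (mul b c)
  one_mul : ∀ a, mul one a = a
  mul_one : ∀ a, mul a one = a
  zero_mul : ∀ a, mul zero a = zero
  mul_zero : ∀ a, mul a zero = zero

namespace StrongBimonoid

variable {B : Type} (S : StrongBimonoid B)

/-- The additive commutative monoid underlying a strong bimonoid. -/
def acm : AddCommMonoid B where
  add := S.add
  zero := S.zero
  add_assoc := S.add_assoc
  zero_add := fun a => (S.add_comm S.zero a).trans (S.add_zero a)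
  add_zero := S.add_zero
  add_comm := S.add_comm
  nsmul := fun n a => Nat.rec S.zero (fun _ ih => S.add ih a) n
  nsmul_zero := fun _ => rfl
  nsmul_succ := fun _ _ => rfl

/-- Finite sum (w.r.t. `S.add`, `S.zero`) of `f` over a finite index set. -/
def fsum {ι : Type} (t : Finset ι) (f : ι → B) : B :=
  @Finset.sum ι B S.acm t f

/-- Ordered product `f 0 ⊗ f 1 ⊗ ⋯ ⊗ f (k-1)` (empty product is `S.one`). -/
def finProd : {k : ℕ} → (Fin k → B) → B
  | 0, _ => S.one
  | _ + 1, f => S.mul (f 0) (finProd (fun i => f i.succ))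

def ZeroSumFree : Prop :=
  ∀ a b, S.add a b = S.zero → a = S.zero ∧ b = S.zero

def StronglyZeroSumFree : Prop :=
  ∀ a b c, S.mul (S.add a b) c = S.zero ↔ (S.mul a c = S.zero ∧ S.mul b c = S.zero)

def BiStronglyZeroSumFree : Prop :=
  ∀ a b b' c, S.mul (S.mul a (S.add b b')) c = S.zero ↔
    (S.mul (S.mul a b) c = S.zero ∧ S.mul (S.mul a b') c = S.zero)

def ZeroDivisorFree : Prop :=
  ∀ a b, S.mul a b = S.zero ↔ (a = S.zero ∨ b = S.zero)

def Positive : Prop := S.ZeroSumFree ∧ S.ZeroDivisorFree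

def RightDistributive : Prop :=
  ∀ a b c, S.mul (S.add a b) c = S.add (S.mul a c) (S.mul b c)

def LeftDistributive : Prop :=
  ∀ a b c, S.mul a (S.add b c) = S.add (S.mul a b) (S.mul a c)

def ZeroRightDistributive : Prop :=
  ∀ a b c, (S.mul (S.add a b) c = S.zero ↔ S.add (S.mul a c) (S.mul b c) = S.zero)

def CommutativeMul : Prop := ∀ a b, S.mul a b = S.mul b a

end StrongBimonoid

/-! Weighted automata over words -/

section Word

variable {B : Type} {Γ : Type} {Q : Type}

/-- The product `μ(a₁)_{ρ₀,ρ₁} ⊗ ⋯ ⊗ μ(aₙ)_{ρₙ₋₁,ρₙ}` of the transition weights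
along the run `ρ` on the word `w = a₁⋯aₙ`. -/
def transProd (S : StrongBimonoid B) (μ : Γ → Q → Q → B) :
    (w : List Γ) → (Fin (w.length + 1) → Q) → B
  | [], _ => S.one
  | a :: w, ρ => S.mul (μ a (ρ 0) (ρ 1)) (transProd S μ w (fun i => ρ i.succ))

/-- Run semantics of the weighted automaton `(Q, I, μ, F)` over `Γ` and `S`. -/
def runSem (S : StrongBimonoid B) [Fintype Q] (I : Q → B) (μ : Γ → Q → Q → B)
    (F : Q → B) (w : List Γ) : B :=
  S.fsum Finset.univ (fun ρ : Fin (w.length + 1) → Q =>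
    S.mul (S.mul (I (ρ 0)) (transProd S μ w ρ)) (F (ρ (Fin.last w.length))))

/-- `hWord S μ w v` is the vector `v ⊗ μ(a₁) ⊗ ⋯ ⊗ μ(aₙ)` (left-associated
vector-matrix products) for `w = a₁⋯aₙ`. -/
def hWord (S : StrongBimonoid B) [Fintype Q] (μ : Γ → Q → Q → B) :
    List Γ → (Q → B) → (Q → B)
  | [], v => v
  | a :: w, v =>
      hWord S μ w (fun q => S.fsum Finset.univ (fun p => S.mul (v p) (μ a p q)))

/-- Initial algebra semantics of the weighted automaton `(Q, I, μ, F)`. -/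
def initSem (S : StrongBimonoid B) [Fintype Q] (I : Q → B) (μ : Γ → Q → Q → B)
    (F : Q → B) (w : List Γ) : B :=
  S.fsum Finset.univ (fun q => S.mul (hWord S μ w I q) (F q))

end Word

/-! Ranked alphabets, trees and weighted tree automata -/

/-- Trees over the ranked alphabet `(σ, rk)`: a node labelled `s` has exactly
`rk s` children. -/
inductive RTree (σ : Type) (rk : σ → ℕ) : Type where
  | node (s : σ) (ts : Fin (rk s) → RTree σ rk) : RTree σ rk

/-- The ranked alphabet is trivial if all symbols have rank 0. -/
def RankTrivial {σ : Type} (rk : σ → ℕ) : Prop := ∀ s, rk s = 0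

/-- The ranked alphabet is branching if some symbol has rank ≥ 2. -/
def RankBranching {σ : Type} (rk : σ → ℕ) : Prop := ∃ s, 2 ≤ rk s

/-- A run of an automaton with state set `Q` on a tree: an assignment of a
state to every position of the tree. -/
inductive TreeRun (σ : Type) (rk : σ → ℕ) (Q : Type) : RTree σ rk → Type where
  | node {s : σ} {ts : Fin (rk s) → RTree σ rk} (q : Q)
      (rs : (i : Fin (rk s)) → TreeRun σ rk Q (ts i)) :
      TreeRun σ rk Q (RTree.node s ts)

/-- The state assigned by a run to the root. -/
def TreeRun.root {σ : Type} {rk : σ → ℕ} {Q : Type} {t : RTree σ rk} :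
    TreeRun σ rk Q t → Q
  | .node q _ => q

def treeRunFintype {σ : Type} {rk : σ → ℕ} (Q : Type) [Fintype Q] :
    (t : RTree σ rk) → Fintype (TreeRun σ rk Q t)
  | RTree.node s ts =>
    letI : ∀ i, Fintype (TreeRun σ rk Q (ts i)) := fun i => treeRunFintype Q (ts i)
    Fintype.ofEquiv (Q × ((i : Fin (rk s)) → TreeRun σ rk Q (ts i)))
      { toFun := fun p => TreeRun.node p.1 p.2
        invFun := fun r => match r with | TreeRun.node q rs => (q, rs)
        left_inv := fun _ => rfl
        right_inv := fun r => match r with | TreeRun.node _ _ => rfl }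

instance {σ : Type} {rk : σ → ℕ} {Q : Type} [Fintype Q] (t : RTree σ rk) :
    Fintype (TreeRun σ rk Q t) := treeRunFintype Q t

/-- The weight of a run on a tree. -/
def treeWt {B : Type} {σ : Type} {rk : σ → ℕ} {Q : Type} (S : StrongBimonoid B)
    (δ : (s : σ) → (Fin (rk s) → Q) → Q → B) :
    (t : RTree σ rk) → TreeRun σ rk Q t → B
  | _, TreeRun.node (s := s) (ts := ts) q rs =>
      S.mul (S.finProd (fun i => treeWt S δ (ts i) (rs i)))
        (δ s (fun i => (rs i).root) q)

/-- Run semantics of the weighted tree automaton `(Q, δ, F)`. -/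
def treeRunSem {B : Type} {σ : Type} {rk : σ → ℕ} {Q : Type} (S : StrongBimonoid B)
    [Fintype Q] (δ : (s : σ) → (Fin (rk s) → Q) → Q → B) (F : Q → B)
    (t : RTree σ rk) : B :=
  S.fsum Finset.univ (fun ρ : TreeRun σ rk Q t => S.mul (treeWt S δ t ρ) (F ρ.root))

/-- The map `h_A : T_Σ → B^Q` of the initial algebra semantics. -/
def treeH {B : Type} {σ : Type} {rk : σ → ℕ} {Q : Type} (S : StrongBimonoid B)
    [Fintype Q] (δ : (s : σ) → (Fin (rk s) → Q) → Q → B) :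
    RTree σ rk → Q → B
  | RTree.node s ts => fun q =>
      S.fsum Finset.univ (fun qs : Fin (rk s) → Q =>
        S.mul (S.finProd (fun i => treeH S δ (ts i) (qs i))) (δ s qs q))

/-- Initial algebra semantics of the weighted tree automaton `(Q, δ, F)`. -/
def treeInitSem {B : Type} {σ : Type} {rk : σ → ℕ} {Q : Type} (S : StrongBimonoid B)
    [Fintype Q] (δ : (s : σ) → (Fin (rk s) → Q) → Q → B) (F : Q → B)
    (t : RTree σ rk) : B :=
  S.fsum Finset.univ (fun q => S.mul (treeH S δ t q) (F q))


namespace StrongBimonoid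

variable {B : Type} (S : StrongBimonoid B)

theorem fsum_empty {ι : Type} (f : ι → B) : S.fsum ∅ f = S.zero := rfl

theorem fsum_insert {ι : Type} [DecidableEq ι] {t : Finset ι} {i : ι} (hi : i ∉ t) (f : ι → B) :
    S.fsum (insert i t) f = S.add (f i) (S.fsum t f) :=
  @Finset.sum_insert ι B t i S.acm f _ hi

theorem fsum_eq_zero {ι : Type} {t : Finset ι} {f : ι → B} (h : ∀ i ∈ t, f i = S.zero) :
    S.fsum t f = S.zero :=
  @Finset.sum_eq_zero ι B t S.acm f h

theorem fsum_bool (f : Bool → B) : S.fsum Finset.univ f = S.add (f true) (f false) :=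
  @Fintype.sum_bool B S.acm f

variable {S}

theorem ZeroSumFree.eq_zero_of_fsum_eq_zero (hS : S.ZeroSumFree) {ι : Type} {t : Finset ι}
    {f : ι → B} (h : S.fsum t f = S.zero) : ∀ i ∈ t, f i = S.zero := by
  classical
  induction t using Finset.induction_on with
  | empty => simp
  | insert i t hi ih =>
    rw [S.fsum_insert hi] at h
    obtain ⟨h₁, h₂⟩ := hS _ _ h
    exact Finset.forall_mem_insert _ _ _ |>.2 ⟨h₁, ih h₂⟩

theorem fsum_mul_eq_zero
    (hS : ∀ a b c : B, S.mul a c = S.zero → S.mul b c = S.zero → S.mul (S.add a b) c = S.zero)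
    {ι : Type} {t : Finset ι} {f : ι → B} {c : B} (h : ∀ i ∈ t, S.mul (f i) c = S.zero) :
    S.mul (S.fsum t f) c = S.zero := by
  classical
  induction t using Finset.induction_on with
  | empty => exact S.zero_mul c
  | insert i t hi ih =>
    rw [S.fsum_insert hi]
    exact hS _ _ _ (h i (Finset.mem_insert_self i t))
      (ih fun j hj => h j (Finset.mem_insert_of_mem hj))

end StrongBimonoid

/-- If every run on `w` ending in `q` has weight annihilated by `c` on the right, then so is
the `q`-component of the vector computed by the initial algebra semantics. -/
theorem hWord_mul_eq_zero {B Γ Q : Type} [Fintype Q] {S : StrongBimonoid B}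
    (hS : ∀ a b c : B, S.mul a c = S.zero → S.mul b c = S.zero → S.mul (S.add a b) c = S.zero)
    (μ : Γ → Q → Q → B) (c : B) (q : Q) (w : List Γ) (v : Q → B)
    (h : ∀ ρ : Fin (w.length + 1) → Q, ρ (Fin.last w.length) = q →
      S.mul (S.mul (v (ρ 0)) (transProd S μ w ρ)) c = S.zero) :
    S.mul (hWord S μ w v q) c = S.zero := by
  induction w generalizing v with
  | nil => simpa [transProd, hWord, S.mul_one] using h (fun _ => q) rfl
  | cons a w ih =>
    refine ih _ fun ρ hρ => ?_
    rw [S.mul_assoc]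
    refine StrongBimonoid.fsum_mul_eq_zero hS fun p _ => ?_
    have key : S.mul (S.mul (v p) (S.mul (μ a p (ρ 0)) (transProd S μ w ρ))) c = S.zero :=
      h (Fin.cons p ρ : Fin (w.length + 1 + 1) → Q) hρ
    simpa only [S.mul_assoc] using key

theorem stmt2 {B : Type} (S : StrongBimonoid B) (Γ : Type) [Fintype Γ] [Nonempty Γ]
    (hzsf : S.ZeroSumFree) :
    (∀ a b c : B, S.mul (S.add a b) c ≠ S.zero →
        (S.mul a c ≠ S.zero ∨ S.mul b c ≠ S.zero)) ↔
      (∀ (Q : Type) [Fintype Q] [Nonempty Q] (I : Q → B) (μ : Γ → Q → Q → B) (F : Q → B),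
        {w : List Γ | initSem S I μ F w ≠ S.zero} ⊆
          {w : List Γ | runSem S I μ F w ≠ S.zero}) := by
  constructor
  · intro h Q _ _ I μ F w hw hrun
    have hS : ∀ a b c : B, S.mul a c = S.zero → S.mul b c = S.zero →
        S.mul (S.add a b) c = S.zero := by
      intro a b c ha hb
      by_contra hab
      exact (h a b c hab).elim (· ha) (· hb)
    refine hw (S.fsum_eq_zero fun q _ => hWord_mul_eq_zero hS μ (F q) q w I ?_)
    rintro ρ rfl
    exact hzsf.eq_zero_of_fsum_eq_zero hrun ρ (Finset.mem_univ ρ)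
  · intro h a b c habc
    by_contra! hac
    obtain ⟨ha, hb⟩ := hac
    obtain ⟨x⟩ := ‹Nonempty Γ›
    refine h Bool (fun p => bif p then a else b) (fun _ _ _ => S.one)
      (fun q => bif q then c else S.zero) (a := [x]) ?_ (S.fsum_eq_zero fun ρ _ => ?_)
    · simpa [initSem, hWord, S.fsum_bool, -Fintype.univ_bool, S.mul_one, S.mul_zero, S.add_zero] using habc
    · simp only [transProd, S.mul_one]
      cases ρ 0 <;> cases ρ (Fin.last [x].length) <;> simp [S.mul_zero, ha, hb]
end

section
/- Let Σ be a ranked alphabet and B be a zero-sum-free strong bimonoid. Then the following two statements are equivalent: (1) if Σ is not trivial then B is strongly zero-sum-free, and if Σ is branching then B is bi-strongly zero-sum-free; (2) for each weighted tree automaton A over Σ and B, supp(⟦A⟧^run) = supp(⟦A⟧^init). -/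
namespace StrongBimonoid

variable {B : Type} (S : StrongBimonoid B)

/-- A predicate that holds at zero and splits over binary sums splits over finite sums. -/
theorem fsum_iff_forall {ι : Type} (φ : B → Prop) (hz : φ S.zero)
    (hadd : ∀ x y, φ (S.add x y) ↔ φ x ∧ φ y) (t : Finset ι) (f : ι → B) :
    φ (S.fsum t f) ↔ ∀ i ∈ t, φ (f i) := by
  classical
  let _ := S.acm
  unfold fsum
  induction t using Finset.induction_on with
  | empty => exact ⟨fun _ i hi => absurd hi (Finset.notMem_empty i), fun _ => hz⟩
  | insert i t hi ih =>
    rw [Finset.sum_insert hi, Finset.forall_mem_insert]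
    exact (hadd _ _).trans (and_congr_right' ih)

theorem ZeroSumFree.fsum_eq_zero_iff {S : StrongBimonoid B} (hS : S.ZeroSumFree)
    {ι : Type} (t : Finset ι) (f : ι → B) :
    S.fsum t f = S.zero ↔ ∀ i ∈ t, f i = S.zero := by
  refine S.fsum_iff_forall (fun x => x = S.zero) rfl (fun x y => ⟨hS x y, ?_⟩) t f
  rintro ⟨rfl, rfl⟩
  exact S.add_zero _

theorem fsum_eq_single {ι : Type} [Fintype ι] (f : ι → B) (i : ι)
    (h : ∀ j, j ≠ i → f j = S.zero) : S.fsum Finset.univ f = f i := by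
  let _ := S.acm
  exact Finset.sum_eq_single i (fun j _ hj => h j hj) (fun hi => absurd (Finset.mem_univ i) hi)

theorem fsum_eq_add {ι : Type} [Fintype ι] (f : ι → B) (i j : ι) (hij : i ≠ j)
    (h : ∀ l, l ≠ i → l ≠ j → f l = S.zero) :
    S.fsum Finset.univ f = S.add (f i) (f j) := by
  let _ := S.acm
  exact Finset.sum_eq_add i j hij (fun l _ hl => h l hl.1 hl.2)
    (fun hi => absurd (Finset.mem_univ i) hi) (fun hj => absurd (Finset.mem_univ j) hj)

theorem finProd_eq_one {k : ℕ} (f : Fin k → B) (h : ∀ i, f i = S.one) :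
    S.finProd f = S.one := by
  induction k with
  | zero => rfl
  | succ k ih =>
    rw [finProd, h, S.one_mul]
    exact ih _ fun i => h _

theorem finProd_eq_mul {k : ℕ} (hk : 2 ≤ k) (f : Fin k → B)
    (h : ∀ i : Fin k, 2 ≤ i.val → f i = S.one) :
    S.finProd f = S.mul (f ⟨0, by omega⟩) (f ⟨1, by omega⟩) := by
  obtain ⟨k, rfl⟩ := Nat.exists_eq_add_of_le' hk
  rw [finProd, finProd, S.finProd_eq_one _ (fun i => h _ (by simp)), S.mul_one]
  rfl

end StrongBimonoid

/-- `Realizes S δ t q w`: some run on `t` with state `q` at the root has weight `w`. -/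
def Realizes {B : Type} {σ : Type} {rk : σ → ℕ} {Q : Type} (S : StrongBimonoid B)
    (δ : (s : σ) → (Fin (rk s) → Q) → Q → B) (t : RTree σ rk) (q : Q) (w : B) : Prop :=
  ∃ ρ : TreeRun σ rk Q t, ρ.root = q ∧ treeWt S δ t ρ = w

section Semantics

variable {B : Type} {σ : Type} {rk : σ → ℕ} {Q : Type} {S : StrongBimonoid B}
  {δ : (s : σ) → (Fin (rk s) → Q) → Q → B}

theorem treeH_node [Fintype Q] (s : σ) (ts : Fin (rk s) → RTree σ rk) (q : Q) :
    treeH S δ (RTree.node s ts) q =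
      S.fsum Finset.univ (fun qs : Fin (rk s) → Q =>
        S.mul (S.finProd (fun i => treeH S δ (ts i) (qs i))) (δ s qs q)) := by
  rw [treeH]

theorem realizes_node_iff {s : σ} {ts : Fin (rk s) → RTree σ rk} {q : Q} {w : B} :
    Realizes S δ (RTree.node s ts) q w ↔
      ∃ (qs : Fin (rk s) → Q) (ws : Fin (rk s) → B),
        (∀ i, Realizes S δ (ts i) (qs i) (ws i)) ∧
          w = S.mul (S.finProd ws) (δ s qs q) := by
  constructor
  · rintro ⟨ρ, rfl, rfl⟩
    cases ρ with
    | node q rs =>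
      exact ⟨fun i => (rs i).root, fun i => treeWt S δ (ts i) (rs i),
        fun i => ⟨rs i, rfl, rfl⟩, by rw [treeWt]; rfl⟩
  · rintro ⟨qs, ws, h, rfl⟩
    choose rs hq hw using h
    obtain rfl : (fun i => (rs i).root) = qs := funext hq
    obtain rfl : (fun i => treeWt S δ (ts i) (rs i)) = ws := funext hw
    exact ⟨TreeRun.node q rs, rfl, by rw [treeWt]⟩

theorem treeRunSem_eq_zero_iff [Fintype Q] (hS : S.ZeroSumFree) (F : Q → B)
    (t : RTree σ rk) :
    treeRunSem S δ F t = S.zero ↔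
      ∀ q w, Realizes S δ t q w → S.mul w (F q) = S.zero := by
  rw [treeRunSem, hS.fsum_eq_zero_iff]
  constructor
  · rintro h q w ⟨ρ, rfl, rfl⟩
    exact h ρ (Finset.mem_univ _)
  · exact fun h ρ _ => h _ _ ⟨ρ, rfl, rfl⟩

theorem treeInitSem_eq_zero_iff [Fintype Q] (hS : S.ZeroSumFree) (F : Q → B)
    (t : RTree σ rk) :
    treeInitSem S δ F t = S.zero ↔ ∀ q, S.mul (treeH S δ t q) (F q) = S.zero := by
  rw [treeInitSem, hS.fsum_eq_zero_iff]
  exact ⟨fun h q => h q (Finset.mem_univ _), fun h q _ => h q⟩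

/-- In a product flanked by `a` and `c`, factors may be replaced one at a time, provided that
this is possible for each factor under every left context that can occur. -/
theorem mul_finProd_eq_zero_iff (P : B → Prop) {k : ℕ}
    (hP : 2 ≤ k → ∀ a, P a) (x : Fin k → B) (R : Fin k → B → Prop)
    (hR : ∀ i a c, P a → (S.mul (S.mul a (x i)) c = S.zero ↔
      ∀ w, R i w → S.mul (S.mul a w) c = S.zero)) (a c : B) (ha : P a) :
    S.mul (S.mul a (S.finProd x)) c = S.zero ↔
      ∀ ws : Fin k → B, (∀ i, R i (ws i)) →
        S.mul (S.mul a (S.finProd ws)) c = S.zero := by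
  induction k generalizing a c with
  | zero => exact ⟨fun h ws _ => h, fun h => h x fun i => i.elim0⟩
  | succ k ih =>
    have split (y : B) (ys : Fin k → B) :
        S.mul (S.mul a (S.mul y (S.finProd ys))) c =
          S.mul (S.mul a y) (S.mul (S.finProd ys) c) := by
      simp only [S.mul_assoc]
    have tail (w : B) :
        S.mul (S.mul a w) (S.mul (S.finProd fun i => x i.succ) c) = S.zero ↔
          ∀ ws : Fin k → B, (∀ i, R i.succ (ws i)) →
            S.mul (S.mul a w) (S.mul (S.finProd ws) c) = S.zero := by
      rcases k with _ | k
      · exact ⟨fun h ws _ => h, fun h => h _ fun i => i.elim0⟩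
      · have := ih (fun _ => hP (by omega)) (fun i => x i.succ) (fun i => R i.succ)
          (fun i => hR i.succ) (S.mul a w) c (hP (by omega) _)
        simpa only [S.mul_assoc] using this
    rw [StrongBimonoid.finProd, split, hR 0 _ _ ha]
    simp only [tail]
    constructor
    · intro h ws hws
      rw [StrongBimonoid.finProd, split]
      exact h _ (hws 0) _ fun i => hws i.succ
    · intro h w hw ws hws
      have := h (Fin.cons w ws) (Fin.cases hw hws)
      rw [StrongBimonoid.finProd, split] at this
      simpa using this

theorem mul_treeH_eq_zero_iff [Fintype Q]
    (h1 : ¬ RankTrivial rk → S.StronglyZeroSumFree)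
    (h2 : RankBranching rk → S.BiStronglyZeroSumFree) (t : RTree σ rk) (q : Q) (a c : B)
    (ha : a = S.one ∨ RankBranching rk) :
    S.mul (S.mul a (treeH S δ t q)) c = S.zero ↔
      ∀ w, Realizes S δ t q w → S.mul (S.mul a w) c = S.zero := by
  induction t generalizing q a c with
  | node s ts ih =>
    have hsum : S.mul (S.mul a (treeH S δ (RTree.node s ts) q)) c = S.zero ↔
        ∀ qs : Fin (rk s) → Q, S.mul (S.mul a (S.mul
          (S.finProd fun i => treeH S δ (ts i) (qs i)) (δ s qs q))) c = S.zero := by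
      rw [treeH_node]
      by_cases hs : rk s = 0
      · have : IsEmpty (Fin (rk s)) := by rw [hs]; infer_instance
        rw [S.fsum_eq_single _ default fun j hj => absurd (Subsingleton.elim _ _) hj]
        refine ⟨fun h qs => ?_, fun h => h _⟩
        rwa [Subsingleton.elim qs default]
      · have key : ∀ x y, S.mul (S.mul a (S.add x y)) c = S.zero ↔
            S.mul (S.mul a x) c = S.zero ∧ S.mul (S.mul a y) c = S.zero := by
          rcases ha with rfl | hb
          · simp only [S.one_mul]
            exact fun x y => h1 (fun ht => hs (ht s)) x y c
          · exact fun x y => h2 hb a x y c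
        rw [S.fsum_iff_forall (fun x => S.mul (S.mul a x) c = S.zero)
          (by rw [S.mul_zero, S.zero_mul]) key]
        simp
    have hprod (qs : Fin (rk s) → Q) :=
      mul_finProd_eq_zero_iff (S := S) (fun a => a = S.one ∨ RankBranching rk)
        (fun hk _ => Or.inr ⟨s, hk⟩) (fun i => treeH S δ (ts i) (qs i))
        (fun i => Realizes S δ (ts i) (qs i)) (fun i => ih i (qs i)) a
        (S.mul (δ s qs q) c) ha
    simp only [S.mul_assoc] at hsum hprod ⊢
    simp only [hsum, hprod, realizes_node_iff]
    constructor
    · rintro h w ⟨qs, ws, hws, rfl⟩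
      rw [S.mul_assoc]
      exact h qs ws hws
    · intro h qs ws hws
      have := h _ ⟨qs, ws, hws, rfl⟩
      rwa [S.mul_assoc] at this

end Semantics

section Witness

variable {B : Type} {σ : Type} {rk : σ → ℕ}

/-- The assignment `0, 1, 2, 2, …`. -/
def childPattern (k : ℕ) : Fin k → Fin 3 :=
  fun i => if i.val = 0 then 0 else if i.val = 1 then 1 else 2

/-- Transition weights of an automaton that computes `a` in state `0` on nullary symbols, the sum
of `b` and `b'` in state `1` on trees of height one, and a product of both in state `2`. -/
def witnessδ (S : StrongBimonoid B) (a b b' : B) (s : σ) (qs : Fin (rk s) → Fin 3)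
    (q : Fin 3) : B :=
  if rk s = 0 then (if q = 0 then a else S.one)
  else if q = 1 then
    (if qs = fun _ => 1 then b else if qs = fun _ => 2 then b' else S.zero)
  else if q = 2 then (if qs = childPattern (rk s) then S.one else S.zero)
  else S.zero

/-- The tree consisting of a single nullary symbol. -/
def leafTree (s₀ : σ) (h₀ : rk s₀ = 0) : RTree σ rk :=
  RTree.node s₀ fun i => (Fin.cast h₀ i).elim0

/-- The tree of height one all of whose leaves are labelled `s₀`. -/
def flatTree (s₀ : σ) (h₀ : rk s₀ = 0) (s : σ) : RTree σ rk :=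
  RTree.node s fun _ => leafTree s₀ h₀

/-- The tree with root `s`, second child `flatTree s₀ h₀ s`, and leaves elsewhere. -/
def nestedTree (s₀ : σ) (h₀ : rk s₀ = 0) (s : σ) : RTree σ rk :=
  RTree.node s fun i => if i.val = 1 then flatTree s₀ h₀ s else leafTree s₀ h₀

variable {S : StrongBimonoid B} {a b b' : B} {s₀ : σ} {h₀ : rk s₀ = 0} {s : σ}

theorem const_one_ne_const_two (hs : rk s ≠ 0) :
    (fun _ : Fin (rk s) => (1 : Fin 3)) ≠ fun _ => 2 := fun h => by
  have := congrFun h ⟨0, Nat.pos_of_ne_zero hs⟩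
  simp at this

theorem treeH_leafTree (q : Fin 3) :
    treeH S (witnessδ S a b b') (leafTree s₀ h₀) q = if q = 0 then a else S.one := by
  have : IsEmpty (Fin (rk s₀)) := by rw [h₀]; infer_instance
  rw [leafTree, treeH_node,
    S.fsum_eq_single _ default fun j hj => absurd (Subsingleton.elim _ _) hj,
    S.finProd_eq_one _ fun i => isEmptyElim i, S.one_mul, witnessδ, if_pos h₀]

theorem treeH_flatTree (hs : rk s ≠ 0) :
    treeH S (witnessδ S a b b') (flatTree s₀ h₀ s) 1 = S.add b b' := by
  have hne := const_one_ne_const_two hs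
  rw [flatTree, treeH_node, S.fsum_eq_add _ (fun _ => 1) (fun _ => 2) hne]
  · rw [S.finProd_eq_one _ fun i => by simp [treeH_leafTree],
      S.finProd_eq_one _ fun i => by simp [treeH_leafTree]]
    simp [witnessδ, hs, hne.symm, S.one_mul]
  · intro qs h1 h2
    simp [witnessδ, hs, h1, h2, S.mul_zero]

theorem treeH_nestedTree (hs : 2 ≤ rk s) :
    treeH S (witnessδ S a b b') (nestedTree s₀ h₀ s) 2 = S.mul a (S.add b b') := by
  have hs' : rk s ≠ 0 := by omega
  rw [nestedTree, treeH_node, S.fsum_eq_single _ (childPattern (rk s))]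
  · rw [S.finProd_eq_mul hs]
    · simp [childPattern, treeH_leafTree, treeH_flatTree hs', witnessδ, hs', S.mul_one]
    · intro i hi
      have h0 : i.val ≠ 0 := by omega
      have h1 : i.val ≠ 1 := by omega
      simp [childPattern, treeH_leafTree, h0, h1]
  · intro qs h
    simp [witnessδ, hs', h, S.mul_zero]

theorem realizes_leafTree_iff (q : Fin 3) (w : B) :
    Realizes S (witnessδ S a b b') (leafTree s₀ h₀) q w ↔
      w = if q = 0 then a else S.one := by
  have : IsEmpty (Fin (rk s₀)) := by rw [h₀]; infer_instance
  have h (qs : Fin (rk s₀) → Fin 3) (ws : Fin (rk s₀) → B) :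
      S.mul (S.finProd ws) (witnessδ S a b b' s₀ qs q) = if q = 0 then a else S.one := by
    rw [S.finProd_eq_one _ fun i => isEmptyElim i, S.one_mul, witnessδ, if_pos h₀]
  rw [leafTree, realizes_node_iff]
  simp only [h]
  exact ⟨fun ⟨_, _, _, hw⟩ => hw,
    fun hw => ⟨isEmptyElim, isEmptyElim, fun i => isEmptyElim i, hw⟩⟩

theorem realizes_flatTree (hs : rk s ≠ 0) :
    Realizes S (witnessδ S a b b') (flatTree s₀ h₀ s) 1 b ∧
      Realizes S (witnessδ S a b b') (flatTree s₀ h₀ s) 1 b' := by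
  have hne := const_one_ne_const_two hs
  constructor <;> rw [flatTree, realizes_node_iff]
  · refine ⟨fun _ => 1, fun _ => S.one, fun i => by simp [realizes_leafTree_iff], ?_⟩
    simp [S.finProd_eq_one, S.one_mul, witnessδ, hs]
  · refine ⟨fun _ => 2, fun _ => S.one, fun i => by simp [realizes_leafTree_iff], ?_⟩
    simp [S.finProd_eq_one, S.one_mul, witnessδ, hs, hne.symm]

theorem eq_of_realizes_flatTree (hs : rk s ≠ 0) {w : B}
    (h : Realizes S (witnessδ S a b b') (flatTree s₀ h₀ s) 1 w) :
    w = b ∨ w = b' ∨ w = S.zero := by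
  rw [flatTree, realizes_node_iff] at h
  obtain ⟨qs, ws, hws, rfl⟩ := h
  simp only [realizes_leafTree_iff] at hws
  by_cases h1 : qs = fun _ => 1
  · subst h1
    left
    rw [S.finProd_eq_one _ fun i => by simp [hws], S.one_mul]
    simp [witnessδ, hs]
  · by_cases h2 : qs = fun _ => 2
    · right; left
      rw [S.finProd_eq_one _ fun i => by simp [hws, h2], S.one_mul]
      simp [witnessδ, hs, h2, (const_one_ne_const_two hs).symm]
    · right; right
      simp [witnessδ, hs, h1, h2, S.mul_zero]

theorem realizes_nestedTree (hs : 2 ≤ rk s) {w : B}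
    (h : Realizes S (witnessδ S a b b') (flatTree s₀ h₀ s) 1 w) :
    Realizes S (witnessδ S a b b') (nestedTree s₀ h₀ s) 2 (S.mul a w) := by
  have hs' : rk s ≠ 0 := by omega
  rw [nestedTree, realizes_node_iff]
  refine ⟨childPattern (rk s),
    fun i => if i.val = 0 then a else if i.val = 1 then w else S.one, fun i => ?_, ?_⟩
  · by_cases h0 : i.val = 0
    · simp [h0, childPattern, realizes_leafTree_iff]
    · by_cases h1 : i.val = 1
      · simpa [h1, childPattern] using h
      · simp [h0, h1, childPattern, realizes_leafTree_iff]
  · rw [S.finProd_eq_mul hs]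
    · simp [witnessδ, hs', S.mul_one]
    · intro i hi
      rw [if_neg (by omega), if_neg (by omega)]

theorem eq_of_realizes_nestedTree (hs : 2 ≤ rk s) {w : B}
    (h : Realizes S (witnessδ S a b b') (nestedTree s₀ h₀ s) 2 w) :
    w = S.mul a b ∨ w = S.mul a b' ∨ w = S.zero := by
  have hs' : rk s ≠ 0 := by omega
  rw [nestedTree, realizes_node_iff] at h
  obtain ⟨qs, ws, hws, rfl⟩ := h
  by_cases hq : qs = childPattern (rk s)
  · subst hq
    have hw0 : ws ⟨0, by omega⟩ = a := by
      simpa [childPattern, realizes_leafTree_iff] using hws ⟨0, by omega⟩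
    have hw1 := hws ⟨1, by omega⟩
    simp only [childPattern, if_true, one_ne_zero, if_false] at hw1
    rw [S.finProd_eq_mul hs, hw0]
    · rcases eq_of_realizes_flatTree hs' hw1 with h | h | h <;>
        simp [h, witnessδ, hs', S.mul_one, S.mul_zero]
    · intro i hi
      have h0 : i.val ≠ 0 := by omega
      have h1 : i.val ≠ 1 := by omega
      simpa [childPattern, h0, h1, realizes_leafTree_iff] using hws i
  · simp [witnessδ, hs', hq, S.mul_zero]

end Witness

/-- Equality of supports, tested with a single final state of weight `c`. -/
theorem treeH_mul_eq_zero_iff_of_supp_eq {B : Type} {σ : Type} {rk : σ → ℕ} {Q : Type}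
    [Fintype Q] {S : StrongBimonoid B} (hS : S.ZeroSumFree)
    {δ : (s : σ) → (Fin (rk s) → Q) → Q → B}
    (h : ∀ F : Q → B, {t : RTree σ rk | treeRunSem S δ F t ≠ S.zero} =
      {t : RTree σ rk | treeInitSem S δ F t ≠ S.zero}) (t : RTree σ rk) (q : Q) (c : B) :
    S.mul (treeH S δ t q) c = S.zero ↔
      ∀ w, Realizes S δ t q w → S.mul w c = S.zero := by
  classical
  have hF := not_iff_not.mp (Set.ext_iff.mp (h fun p => if p = q then c else S.zero) t)
  rw [treeRunSem_eq_zero_iff hS, treeInitSem_eq_zero_iff hS] at hF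
  constructor
  · intro hc w hw
    simpa using hF.mpr (fun p => by
      by_cases hp : p = q
      · simpa [hp] using hc
      · simp [hp, S.mul_zero]) q w hw
  · intro hc
    simpa using hF.mp (fun p w hw => by
      by_cases hp : p = q
      · subst hp
        simpa using hc w hw
      · simp [hp, S.mul_zero]) q

theorem stmt13 {B : Type} (S : StrongBimonoid B)
    (σt : Type) [Fintype σt] [Nonempty σt] (rk : σt → ℕ) (h0 : ∃ s, rk s = 0)
    (hzsf : S.ZeroSumFree) :
    ((¬ RankTrivial rk → S.StronglyZeroSumFree) ∧
      (RankBranching rk → S.BiStronglyZeroSumFree)) ↔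
      (∀ (Q : Type) [Fintype Q] [Nonempty Q] (δ : (s : σt) → (Fin (rk s) → Q) → Q → B) (F : Q → B),
        {t : RTree σt rk | treeRunSem S δ F t ≠ S.zero} =
          {t : RTree σt rk | treeInitSem S δ F t ≠ S.zero}) := by
  constructor
  · rintro ⟨h1, h2⟩ Q _ _ δ F
    ext t
    refine not_congr ?_
    rw [treeRunSem_eq_zero_iff hzsf, treeInitSem_eq_zero_iff hzsf]
    refine forall_congr' fun q => ?_
    have := mul_treeH_eq_zero_iff (δ := δ) h1 h2 t q S.one (F q) (Or.inl rfl)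
    simp only [S.one_mul] at this
    exact this.symm
  · intro h
    obtain ⟨s₀, h₀⟩ := h0
    constructor
    · intro ht b b' c
      obtain ⟨s, hs⟩ := not_forall.mp ht
      rw [← treeH_flatTree (S := S) (a := S.one) (b := b) (b' := b') (h₀ := h₀) hs,
        treeH_mul_eq_zero_iff_of_supp_eq hzsf (h (Fin 3) _)]
      refine ⟨fun hw => ⟨hw _ (realizes_flatTree hs).1, hw _ (realizes_flatTree hs).2⟩, ?_⟩
      rintro ⟨hb, hb'⟩ w hw
      rcases eq_of_realizes_flatTree hs hw with rfl | rfl | rfl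
      exacts [hb, hb', S.zero_mul _]
    · rintro ⟨s, hs⟩ a b b' c
      have hs' : rk s ≠ 0 := by omega
      rw [← treeH_nestedTree (S := S) (a := a) (b := b) (b' := b') (h₀ := h₀) hs,
        treeH_mul_eq_zero_iff_of_supp_eq hzsf (h (Fin 3) _)]
      refine ⟨fun hw => ⟨hw _ (realizes_nestedTree hs (realizes_flatTree hs').1),
        hw _ (realizes_nestedTree hs (realizes_flatTree hs').2)⟩, ?_⟩
      rintro ⟨hb, hb'⟩ w hw
      rcases eq_of_realizes_nestedTree hs hw with rfl | rfl | rfl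
      exacts [hb, hb', S.zero_mul _]
end
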